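/- If a dyadic subdivision scheme with mask (c_k) converges, then its limit function φ on the delta sequence satisfies the dyadic refinement equation φ(x) = Σ_k c_k φ(2x ⊖ k). -/

import Mathlib

/-- The `n`-th binary digit of a nonnegative real `x` (digit of weight `2^n`). -/
noncomputable def rbit (x : ℝ) (n : ℤ) : ℕ := ⌊x / (2 : ℝ) ^ n⌋.toNat % 2

/-- Dyadic (carry-free, digitwise XOR) addition on the dyadic half-line `ℝ₊`:
the number whose binary digits are the XORs of the binary digits of `x` and `y`.
Since `⊕` is an involution, it coincides with dyadic subtraction `⊖`. -/
noncomputable def dAdd (x y : ℝ) : ℝ :=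
  ∑' n : ℤ, (((rbit x n) ^^^ (rbit y n) : ℕ) : ℝ) * (2 : ℝ) ^ n

/-- `W`-continuity: `f` is continuous with respect to the dyadic metric,
i.e. `f(x ⊕ h) → f(x)` as `h → 0+`, at every point of the half-line. -/
def WCont (f : ℝ → ℝ) : Prop :=
  ∀ x : ℝ, 0 ≤ x → ∀ ε : ℝ, 0 < ε → ∃ δ : ℝ, 0 < δ ∧
    ∀ h : ℝ, 0 ≤ h → h < δ → |f (dAdd x h) - f x| < ε

/-- The dyadic subdivision operator with mask `c` supported on `{0, …, N}`:
`(Sa)(α) = Σ_β c_{α ⊖ 2β} a_β` (the sum is finite since the mask is). -/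
noncomputable def Sop (c : ℕ → ℝ) (N : ℕ) (a : ℕ → ℝ) : ℕ → ℝ :=
  fun α => ∑ β ∈ Finset.range (α + N + 1), c (α ^^^ (2 * β)) * a β

/-- A bounded sequence. -/
def BddSeq (a : ℕ → ℝ) : Prop := ∃ C : ℝ, ∀ k, |a k| ≤ C

/-- The delta sequence `δ = (1, 0, 0, …)`. -/
def deltaSeq : ℕ → ℝ := fun k => if k = 0 then 1 else 0

/-- The dyadic subdivision scheme with mask `c` converges on the sequence `a`
to the `W`-continuous function `f`: `‖f(2⁻ⁿ·) − (Sⁿa)(·)‖_∞ → 0`. -/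
noncomputable def ConvergesTo (c : ℕ → ℝ) (N : ℕ) (a : ℕ → ℝ) (f : ℝ → ℝ) : Prop :=
  WCont f ∧ ∀ ε : ℝ, 0 < ε → ∃ M : ℕ, ∀ n ≥ M, ∀ k : ℕ,
    |f ((2 : ℝ) ^ (-(n : ℤ)) * k) - ((Sop c N)^[n] a) k| < ε

open Filter Topology

namespace Nat

theorem xor_le_add (a b : ℕ) : a ^^^ b ≤ a + b := by
  induction a using Nat.strong_induction_on generalizing b with
  | _ a ih =>
    rcases Nat.eq_zero_or_pos a with rfl | ha
    · simp
    · have h₁ := ih (a / 2) (by omega) (b / 2)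
      have h₂ : (a ^^^ b) / 2 = a / 2 ^^^ b / 2 := Nat.xor_div_two
      have h₃ : (a ^^^ b) % 2 = (a + b) % 2 := Nat.xor_mod_two_eq
      omega

theorem two_pow_mul_xor (n a b : ℕ) : 2 ^ n * (a ^^^ b) = 2 ^ n * a ^^^ 2 ^ n * b := by
  have h := @Nat.shiftLeft_xor_distrib n a b
  simpa only [Nat.shiftLeft_eq, mul_comm] using h

theorem two_pow_mul_add_xor_two_pow_mul (m a k : ℕ) {b : ℕ} (hb : b < 2 ^ m) :
    (2 ^ m * a + b) ^^^ 2 ^ m * k = 2 ^ m * (a ^^^ k) + b := by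
  refine Nat.eq_of_testBit_eq fun j => ?_
  rw [Nat.testBit_xor, Nat.testBit_two_pow_mul_add _ hb, Nat.testBit_two_pow_mul_add _ hb,
    Nat.testBit_two_pow_mul, Nat.testBit_xor]
  by_cases h : j < m
  · simp [h, not_le.mpr h]
  · simp [h, not_lt.mp h]

end Nat

theorem rbit_eq_floor (x : ℝ) (n : ℤ) : rbit x n = ⌊x / (2 : ℝ) ^ n⌋₊ % 2 := by
  rw [rbit, Int.floor_toNat]

theorem rbit_zero (n : ℤ) : rbit 0 n = 0 := by
  simp [rbit]

theorem rbit_div_two_pow (x : ℝ) (m : ℕ) (n : ℤ) : rbit (x / 2 ^ m) n = rbit x (n + m) := by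
  rw [rbit, rbit, zpow_add₀ two_ne_zero, zpow_natCast, div_div, mul_comm]

theorem rbit_natCast_add_of_nonneg (a : ℕ) {f : ℝ} (hf₀ : 0 ≤ f) (hf₁ : f < 1) (n : ℕ) :
    rbit (a + f) n = a / 2 ^ n % 2 := by
  have h : ⌊(a : ℝ) + f⌋₊ = a := by
    rw [add_comm, Nat.floor_add_natCast hf₀, Nat.floor_eq_zero.mpr hf₁, zero_add]
  have h₂ := Nat.floor_div_natCast ((a : ℝ) + f) (2 ^ n)
  rw [h] at h₂
  rw [rbit_eq_floor, zpow_natCast, ← h₂]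
  norm_cast

theorem rbit_natCast_add_of_neg (a : ℕ) {f : ℝ} (hf₀ : 0 ≤ f) (n : ℕ) :
    rbit (a + f) (Int.negSucc n) = rbit f (Int.negSucc n) := by
  have h : ((a : ℝ) + f) * 2 ^ (n + 1) = f * 2 ^ (n + 1) + (a * 2 ^ (n + 1) : ℕ) := by
    push_cast; ring
  rw [rbit_eq_floor, rbit_eq_floor, zpow_negSucc, div_inv_eq_mul, div_inv_eq_mul, h,
    Nat.floor_add_natCast (by positivity), pow_succ (2 : ℕ) n, ← mul_assoc a, Nat.add_mul_mod_self_right]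

theorem rbit_natCast_of_neg (a n : ℕ) : rbit a (Int.negSucc n) = 0 := by
  simpa [rbit_zero] using rbit_natCast_add_of_neg a le_rfl n

theorem rbit_natCast_of_nonneg (a n : ℕ) : rbit a n = a / 2 ^ n % 2 := by
  simpa using rbit_natCast_add_of_nonneg a le_rfl zero_lt_one n

theorem rbit_of_lt_one {f : ℝ} (hf₀ : 0 ≤ f) (hf₁ : f < 1) (n : ℕ) : rbit f n = 0 := by
  simpa using rbit_natCast_add_of_nonneg 0 hf₀ hf₁ n

theorem rbit_mul_two_zpow (x : ℝ) (n : ℤ) :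
    (rbit x n : ℝ) * 2 ^ n =
      ⌊x / 2 ^ n⌋₊ * (2 : ℝ) ^ n - ⌊x / 2 ^ (n + 1)⌋₊ * (2 : ℝ) ^ (n + 1) := by
  have h : ⌊x / (2 : ℝ) ^ (n + 1)⌋₊ = ⌊x / (2 : ℝ) ^ n⌋₊ / 2 := by
    rw [zpow_add_one₀ two_ne_zero, ← div_div]
    exact_mod_cast Nat.floor_div_natCast (x / (2 : ℝ) ^ n) 2
  have h₂ : (⌊x / (2 : ℝ) ^ n⌋₊ : ℝ) =
      2 * (⌊x / (2 : ℝ) ^ n⌋₊ / 2 : ℕ) + (⌊x / (2 : ℝ) ^ n⌋₊ % 2 : ℕ) := by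
    exact_mod_cast (Nat.div_add_mod _ 2).symm
  rw [rbit_eq_floor, h, zpow_add_one₀ two_ne_zero]
  linear_combination -(2 : ℝ) ^ n * h₂

theorem tendsto_floor_mul_two_pow_div {x : ℝ} (hx : 0 ≤ x) :
    Tendsto (fun n : ℕ => (⌊x * 2 ^ n⌋₊ : ℝ) / 2 ^ n) atTop (𝓝 x) :=
  (tendsto_nat_floor_mul_div_atTop hx).comp (tendsto_pow_atTop_atTop_of_one_lt one_lt_two)

theorem hasSum_rbit {x : ℝ} (hx : 0 ≤ x) :
    HasSum (fun n : ℤ => (rbit x n : ℝ) * (2 : ℝ) ^ n) x := by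
  have hpos : HasSum (fun n : ℕ => (rbit x n : ℝ) * (2 : ℝ) ^ (n : ℤ)) ⌊x⌋₊ := by
    rw [hasSum_iff_tendsto_nat_of_nonneg fun n => by positivity]
    have hsum (n : ℕ) : ∑ i ∈ Finset.range n, (rbit x i : ℝ) * (2 : ℝ) ^ (i : ℤ) =
        ⌊x⌋₊ - ⌊x / 2 ^ n⌋₊ * 2 ^ n := by
      have := Finset.sum_range_sub' (fun n : ℕ => (⌊x / 2 ^ n⌋₊ : ℝ) * 2 ^ n) n
      simp only [pow_zero, div_one, mul_one] at this
      rw [← this]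
      refine Finset.sum_congr rfl fun i _ => ?_
      rw [rbit_mul_two_zpow]
      norm_cast
    simp only [hsum]
    refine tendsto_const_nhds.congr' ?_
    obtain ⟨n₀, hn₀⟩ := pow_unbounded_of_one_lt x one_lt_two
    filter_upwards [eventually_ge_atTop n₀] with n hn
    have hlt : x < 2 ^ n := hn₀.trans_le (pow_le_pow_right₀ one_le_two hn)
    rw [Nat.floor_eq_zero.mpr ((div_lt_one (by positivity)).mpr hlt)]
    simp
  have hneg : HasSum (fun n : ℕ => (rbit x (-((n : ℤ) + 1)) : ℝ) * (2 : ℝ) ^ (-((n : ℤ) + 1)))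
      (x - ⌊x⌋₊) := by
    rw [hasSum_iff_tendsto_nat_of_nonneg fun n => by positivity]
    have hsum (n : ℕ) : ∑ i ∈ Finset.range n,
        (rbit x (-((i : ℤ) + 1)) : ℝ) * (2 : ℝ) ^ (-((i : ℤ) + 1)) =
        ⌊x * 2 ^ n⌋₊ / 2 ^ n - ⌊x⌋₊ := by
      have := Finset.sum_range_sub (fun n : ℕ => (⌊x * 2 ^ n⌋₊ : ℝ) / 2 ^ n) n
      simp only [pow_zero, div_one, mul_one] at this
      rw [← this]
      refine Finset.sum_congr rfl fun i _ => ?_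
      have h₁ : (-((i : ℤ) + 1) + 1) = -(i : ℤ) := by ring
      have h₂ : (-((i : ℤ) + 1)) = -((i + 1 : ℕ) : ℤ) := by push_cast; ring
      rw [rbit_mul_two_zpow, h₁, h₂]
      simp only [zpow_neg, zpow_natCast, div_inv_eq_mul, ← div_eq_mul_inv]
    simp only [hsum]
    exact (tendsto_floor_mul_two_pow_div hx).sub_const _
  have h := HasSum.of_nat_of_neg_add_one (f := fun n : ℤ => (rbit x n : ℝ) * (2 : ℝ) ^ n) hpos hneg
  rwa [add_sub_cancel] at h

theorem dAdd_eq_of_rbit {x y z : ℝ} (hz : 0 ≤ z)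
    (h : ∀ n, rbit x n ^^^ rbit y n = rbit z n) : dAdd x y = z := by
  simp only [dAdd, h]
  exact (hasSum_rbit hz).tsum_eq

theorem dAdd_natCast_add_natCast (a k : ℕ) {f : ℝ} (hf₀ : 0 ≤ f) (hf₁ : f < 1) :
    dAdd (a + f) k = (a ^^^ k : ℕ) + f := by
  refine dAdd_eq_of_rbit (by positivity) fun n => ?_
  cases n with
  | ofNat n =>
    rw [Int.ofNat_eq_natCast, rbit_natCast_add_of_nonneg _ hf₀ hf₁, rbit_natCast_of_nonneg,
      rbit_natCast_add_of_nonneg _ hf₀ hf₁, Nat.xor_div_two_pow]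
    simpa using (Nat.xor_mod_two_pow (a := a / 2 ^ n) (b := k / 2 ^ n) (n := 1)).symm
  | negSucc n =>
    rw [rbit_natCast_add_of_neg _ hf₀, rbit_natCast_add_of_neg _ hf₀, rbit_natCast_of_neg,
      Nat.xor_zero]

theorem dAdd_div_two_pow_fract (a m : ℕ) {f : ℝ} (hf₀ : 0 ≤ f) (hf₁ : f < 1) :
    dAdd ((a + f) / 2 ^ m) (f / 2 ^ m) = a / 2 ^ m := by
  refine dAdd_eq_of_rbit (by positivity) fun n => ?_
  simp only [rbit_div_two_pow]
  cases n + m with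
  | ofNat n =>
    rw [Int.ofNat_eq_natCast, rbit_natCast_add_of_nonneg _ hf₀ hf₁, rbit_natCast_of_nonneg,
      rbit_of_lt_one hf₀ hf₁, Nat.xor_zero]
  | negSucc n => rw [rbit_natCast_add_of_neg _ hf₀, rbit_natCast_of_neg, Nat.xor_self]

theorem WCont.tendsto_floor {f : ℝ → ℝ} (hf : WCont f) {x : ℝ} (hx : 0 ≤ x) :
    Tendsto (fun n : ℕ => f (⌊x * 2 ^ n⌋₊ / 2 ^ n)) atTop (𝓝 (f x)) := by
  rw [Metric.tendsto_atTop']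
  intro ε hε
  obtain ⟨δ, hδ, h⟩ := hf x hx ε hε
  obtain ⟨n₀, hn₀⟩ := pow_unbounded_of_one_lt δ⁻¹ (one_lt_two (α := ℝ))
  refine ⟨n₀, fun n hn => ?_⟩
  set r : ℝ := x * 2 ^ n - ⌊x * 2 ^ n⌋₊ with hr
  have hr₀ : 0 ≤ r := sub_nonneg.mpr (Nat.floor_le (by positivity))
  have hr₁ : r < 1 := by linarith [Nat.lt_floor_add_one (x * 2 ^ n)]
  have hx' : x = (⌊x * 2 ^ n⌋₊ + r) / 2 ^ n := by rw [hr]; field_simp; ring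
  have hlt : δ⁻¹ < 2 ^ n := hn₀.trans (pow_lt_pow_right₀ one_lt_two hn)
  have hsmall : r / 2 ^ n < δ := by
    rw [div_lt_iff₀ (by positivity)]
    have := mul_lt_mul_of_pos_left hlt hδ
    rw [mul_inv_cancel₀ hδ.ne'] at this
    linarith
  have hd : dAdd x (r / 2 ^ n) = ⌊x * 2 ^ n⌋₊ / 2 ^ n := by
    conv_lhs => rw [hx']
    exact dAdd_div_two_pow_fract _ _ hr₀ hr₁
  rw [Real.dist_eq, ← hd]
  exact h _ (by positivity) hsmall

theorem ConvergesTo.tendsto_iterate {c : ℕ → ℝ} {N : ℕ} {a : ℕ → ℝ} {f : ℝ → ℝ}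
    (h : ConvergesTo c N a f) {x : ℝ} (hx : 0 ≤ x) :
    Tendsto (fun n : ℕ => ((Sop c N)^[n] a) ⌊x * 2 ^ n⌋₊) atTop (𝓝 (f x)) := by
  have hdiff : Tendsto (fun n : ℕ => f (⌊x * 2 ^ n⌋₊ / 2 ^ n) -
      ((Sop c N)^[n] a) ⌊x * 2 ^ n⌋₊) atTop (𝓝 0) := by
    rw [Metric.tendsto_atTop]
    intro ε hε
    obtain ⟨M, hM⟩ := h.2 ε hε
    refine ⟨M, fun n hn => ?_⟩
    have := hM n hn ⌊x * 2 ^ n⌋₊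
    rwa [zpow_neg, zpow_natCast, mul_comm, ← div_eq_mul_inv, ← sub_zero (_ - _),
      ← Real.dist_eq] at this
  simpa using (h.1.tendsto_floor hx).sub hdiff

section SubdivisionOperator

variable {c : ℕ → ℝ} {N : ℕ}

theorem Sop_eq_sum_range (hc : ∀ k, N < k → c k = 0) (a : ℕ → ℝ) (α : ℕ) {M : ℕ}
    (hM : α + N + 1 ≤ M) : Sop c N a α = ∑ β ∈ Finset.range M, c (α ^^^ (2 * β)) * a β := by
  refine Finset.sum_subset (Finset.range_subset_range.mpr hM) fun β _ hβ => ?_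
  have h := Nat.xor_le_add α (α ^^^ (2 * β))
  rw [← Nat.xor_assoc, Nat.xor_self, Nat.zero_xor] at h
  rw [Finset.mem_range] at hβ
  rw [hc _ (by omega), zero_mul]

theorem Sop_xor (hc : ∀ k, N < k → c k = 0) (a : ℕ → ℝ) (t α : ℕ) :
    Sop c N (fun β => a (β ^^^ t)) α = Sop c N a (α ^^^ (2 * t)) := by
  obtain ⟨L, hL⟩ := pow_unbounded_of_one_lt (α + (α ^^^ (2 * t)) + t + N + 1) one_lt_two
  rw [Sop_eq_sum_range hc _ α (M := 2 ^ L) (by omega),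
    Sop_eq_sum_range hc _ (α ^^^ (2 * t)) (M := 2 ^ L) (by omega)]
  have ht : t < 2 ^ L := by omega
  have hinv (β : ℕ) : β ^^^ t ^^^ t = β := by rw [Nat.xor_assoc, Nat.xor_self, Nat.xor_zero]
  refine Finset.sum_nbij' (· ^^^ t) (· ^^^ t)
    (fun β hβ => Finset.mem_range.mpr (Nat.xor_lt_two_pow (Finset.mem_range.mp hβ) ht))
    (fun β hβ => Finset.mem_range.mpr (Nat.xor_lt_two_pow (Finset.mem_range.mp hβ) ht))
    (fun β _ => hinv β) (fun β _ => hinv β) fun β _ => ?_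
  have h2 : 2 * (β ^^^ t) = 2 * t ^^^ 2 * β := by
    rw [Nat.xor_comm]
    simpa using Nat.two_pow_mul_xor 1 t β
  rw [h2, Nat.xor_assoc, ← Nat.xor_assoc (2 * t), Nat.xor_self, Nat.zero_xor]

theorem Sop_sum {ι : Type*} (s : Finset ι) (w : ι → ℝ) (g : ι → ℕ → ℝ) (α : ℕ) :
    Sop c N (fun β => ∑ k ∈ s, w k * g k β) α = ∑ k ∈ s, w k * Sop c N (g k) α := by
  simp only [Sop, Finset.mul_sum]
  rw [Finset.sum_comm]
  exact Finset.sum_congr rfl fun _ _ => Finset.sum_congr rfl fun _ _ => by ring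

theorem Sop_deltaSeq (α : ℕ) : Sop c N deltaSeq α = c α := by
  simp [Sop, deltaSeq]

theorem iterate_succ_Sop_deltaSeq (hc : ∀ k, N < k → c k = 0) (n α : ℕ) :
    ((Sop c N)^[n + 1] deltaSeq) α =
      ∑ k ∈ Finset.range (N + 1), c k * ((Sop c N)^[n] deltaSeq) (α ^^^ (2 ^ n * k)) := by
  induction n generalizing α with
  | zero =>
    simp only [zero_add, Function.iterate_one, Function.iterate_zero, id, pow_zero, one_mul,
      Sop_deltaSeq, deltaSeq, Nat.xor_eq_zero_iff, mul_ite, mul_one, mul_zero,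
      Finset.sum_ite_eq, Finset.mem_range]
    split_ifs with h
    · rfl
    · exact hc α (by omega)
  | succ n ih =>
    conv_lhs => rw [Function.iterate_succ_apply', funext ih, Sop_sum]
    refine Finset.sum_congr rfl fun k _ => ?_
    rw [Sop_xor hc, Function.iterate_succ_apply', pow_succ', mul_assoc]

end SubdivisionOperator

theorem floor_dAdd_natCast_mul_two_pow {z : ℝ} (hz : 0 ≤ z) (k n : ℕ) :
    0 ≤ dAdd z k ∧ ⌊dAdd z k * 2 ^ n⌋₊ = ⌊z * 2 ^ n⌋₊ ^^^ (2 ^ n * k) := by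
  set a := ⌊z⌋₊
  set f : ℝ := z - a with hf
  have hf₀ : 0 ≤ f := sub_nonneg.mpr (Nat.floor_le hz)
  have hf₁ : f < 1 := by linarith [Nat.lt_floor_add_one z]
  have hfloor (j : ℕ) : ⌊((j : ℝ) + f) * 2 ^ n⌋₊ = 2 ^ n * j + ⌊f * 2 ^ n⌋₊ := by
    have h : ((j : ℝ) + f) * 2 ^ n = f * 2 ^ n + (2 ^ n * j : ℕ) := by push_cast; ring
    rw [h, Nat.floor_add_natCast (by positivity), add_comm]
  have hz' : z = a + f := by rw [hf]; ring
  have hlt : ⌊f * 2 ^ n⌋₊ < 2 ^ n := by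
    rw [Nat.floor_lt (by positivity)]
    push_cast
    exact mul_lt_of_lt_one_left (by positivity) hf₁
  rw [hz', dAdd_natCast_add_natCast _ _ hf₀ hf₁, hfloor, hfloor,
    Nat.two_pow_mul_add_xor_two_pow_mul _ _ _ hlt]
  exact ⟨by positivity, rfl⟩

/-- If a dyadic subdivision scheme with mask `(c_k)` converges, then its limit
function on the delta sequence satisfies the dyadic refinement equation
`φ(x) = Σ_k c_k φ(2x ⊖ k)`. -/
theorem limit_function_satisfies_refinement_equation
    (c : ℕ → ℝ) (N : ℕ) (hc : ∀ k, N < k → c k = 0)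
    (hconv : ∀ a : ℕ → ℝ, BddSeq a → ∃ f : ℝ → ℝ, ConvergesTo c N a f)
    (φ : ℝ → ℝ) (hφ : ConvergesTo c N deltaSeq φ) :
    ∀ x : ℝ, 0 ≤ x → φ x = ∑ k ∈ Finset.range (N + 1), c k * φ (dAdd (2 * x) k) := by
  intro x hx
  have hx₂ : 0 ≤ 2 * x := by positivity
  have hl := (hφ.tendsto_iterate hx).comp (tendsto_add_atTop_nat 1)
  have hr := tendsto_finsetSum (Finset.range (N + 1)) fun k _ =>
    (hφ.tendsto_iterate (floor_dAdd_natCast_mul_two_pow hx₂ k 0).1).const_mul (c k)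
  refine tendsto_nhds_unique (hl.congr fun n => ?_) hr
  have h : x * 2 ^ (n + 1) = 2 * x * 2 ^ n := by ring
  rw [Function.comp_apply, h, iterate_succ_Sop_deltaSeq hc]
  refine Finset.sum_congr rfl fun k _ => ?_
  rw [(floor_dAdd_natCast_mul_two_pow hx₂ k n).2]
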